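/- arXiv:2008.04896 — 2 statements merged into one kernel-verified Lean document; each statement's English description precedes it below -/
import Mathlib

section
/- For n ≥ 3k and k ≥ 3 with k ≠ 4 (and n ≥ 18 if k = 3), the metric dimension of the Kneser graph satisfies β(K(k,n)) ≥ n/2 + n/k. For k = 4 and n ≥ 12, β(K(4,n)) ≥ (3n−1)/4. -/
/-- The Kneser graph `K(k,n)`: vertices are the `k`-subsets of `[n]`,
adjacent iff disjoint. -/
def Kneser (k n : ℕ) : SimpleGraph {s : Finset (Fin n) // s.card = k} :=
  SimpleGraph.fromRel (fun u v => Disjoint u.1 v.1)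

/-- `S` is a resolving set of `G`. -/
def IsResolvingSet {V : Type*} (G : SimpleGraph V) (S : Set V) : Prop :=
  ∀ u v : V, (∀ s ∈ S, G.dist s u = G.dist s v) → u = v

lemma kneser_adj {k n : ℕ} (hk : 3 ≤ k) (u v : {s : Finset (Fin n) // s.card = k}) :
    (Kneser k n).Adj u v ↔ Disjoint u.1 v.1 := by
  unfold Kneser
  rw [SimpleGraph.fromRel_adj]
  constructor
  · rintro ⟨_, h | h⟩
    · exact h
    · exact h.symm
  · intro h
    refine ⟨?_, Or.inl h⟩
    rintro rfl
    have h2 := u.2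
    rw [disjoint_self] at h
    simp only [Finset.bot_eq_empty] at h
    rw [h] at h2
    simp at h2
    omega

lemma kneser_dist_two {k n : ℕ} (hk : 3 ≤ k) (hn : 3 * k ≤ n)
    (u v : {s : Finset (Fin n) // s.card = k}) (huv : u ≠ v) (h : ¬ Disjoint u.1 v.1) :
    (Kneser k n).dist u v = 2 := by
  have hc : k ≤ (Finset.univ \ (u.1 ∪ v.1)).card := by
    have h1 := Finset.le_card_sdiff (u.1 ∪ v.1) Finset.univ
    have h2 := Finset.card_union_le u.1 v.1
    rw [u.2, v.2] at h2
    simp only [Finset.card_univ, Fintype.card_fin] at h1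
    omega
  obtain ⟨w, hw, hwc⟩ := Finset.exists_subset_card_eq hc
  have hwu : Disjoint w u.1 := by
    rw [Finset.disjoint_left]
    intro a ha hb
    have := hw ha
    simp at this
    exact this.1 hb
  have hwv : Disjoint w v.1 := by
    rw [Finset.disjoint_left]
    intro a ha hb
    have := hw ha
    simp at this
    exact this.2 hb
  have a1 : (Kneser k n).Adj u ⟨w, hwc⟩ := (kneser_adj hk _ _).2 hwu.symm
  have a2 : (Kneser k n).Adj ⟨w, hwc⟩ v := (kneser_adj hk _ _).2 hwv
  let p : (Kneser k n).Walk u v := .cons a1 (.cons a2 .nil)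
  have hle : (Kneser k n).dist u v ≤ 2 := SimpleGraph.dist_le p
  have h0 : (Kneser k n).dist u v ≠ 0 := by
    intro h0
    rw [SimpleGraph.Reachable.dist_eq_zero_iff ⟨p⟩] at h0
    exact huv h0
  have h1 : (Kneser k n).dist u v ≠ 1 := by
    intro h1
    rw [SimpleGraph.dist_eq_one_iff_adj, kneser_adj hk] at h1
    exact h h1
  omega

/-- Combinatorial form of the resolving property. -/
def Separates {n : ℕ} (k : ℕ) (F : Finset (Finset (Fin n))) : Prop :=
  ∀ u v : Finset (Fin n), u.card = k → v.card = k →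
    (∀ s ∈ F, s ≠ u ∧ s ≠ v ∧ (Disjoint s u ↔ Disjoint s v)) → u = v

lemma separates_of_resolving {k n : ℕ} (hk : 3 ≤ k) (hn : 3 * k ≤ n)
    (S : Finset {s : Finset (Fin n) // s.card = k})
    (hres : IsResolvingSet (Kneser k n) ↑S) :
    Separates k (S.image Subtype.val) := by
  intro u v hu hv h
  have := hres ⟨u, hu⟩ ⟨v, hv⟩ (by
    intro s hs
    obtain ⟨h1, h2, h3⟩ := h s.1 (Finset.mem_image_of_mem _ hs)
    by_cases hd : Disjoint s.1 u
    · rw [SimpleGraph.dist_eq_one_iff_adj.2 ((kneser_adj hk _ _).2 hd),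
        SimpleGraph.dist_eq_one_iff_adj.2 ((kneser_adj hk _ _).2 (h3.1 hd))]
    · rw [kneser_dist_two hk hn s ⟨u, hu⟩ (fun e => h1 (congrArg Subtype.val e)) hd,
        kneser_dist_two hk hn s ⟨v, hv⟩ (fun e => h2 (congrArg Subtype.val e))
          (fun e => hd (h3.2 e))])
  exact congrArg Subtype.val this

/-- Edges containing exactly one of `x`, `y`. -/
def symEdges {n : ℕ} (F : Finset (Finset (Fin n))) (x y : Fin n) : Finset (Finset (Fin n)) :=
  F.filter (fun s => (x ∈ s ∧ y ∉ s) ∨ (y ∈ s ∧ x ∉ s))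

lemma no_transversal {n k : ℕ} (F : Finset (Finset (Fin n))) (hF : Separates k F) (x y : Fin n)
    (hk : 3 ≤ k) (hxy : x ≠ y) (A : Finset (Fin n)) (hA : A.card = k - 1) (hx : x ∉ A) (hy : y ∉ A)
    (hit : ∀ e ∈ symEdges F x y, ∃ z ∈ A, z ∈ e) :
    insert x A ∈ symEdges F x y ∨ insert y A ∈ symEdges F x y := by
  by_contra hcon
  rw [not_or] at hcon
  obtain ⟨c1, c2⟩ := hcon
  have hx' : x ∉ insert y A := by simp [hx, hxy]
  have hy' : y ∉ insert x A := by simp [hy, hxy.symm]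
  have := hF (insert x A) (insert y A) (by rw [Finset.card_insert_of_notMem hx]; omega)
    (by rw [Finset.card_insert_of_notMem hy]; omega) (by
      intro s hs
      refine ⟨?_, ?_, ?_⟩
      · rintro rfl
        exact c1 (Finset.mem_filter.2 ⟨hs, Or.inl ⟨by simp, hy'⟩⟩)
      · rintro rfl
        exact c2 (Finset.mem_filter.2 ⟨hs, Or.inr ⟨by simp, hx'⟩⟩)
      · by_cases hm : s ∈ symEdges F x y
        · obtain ⟨z, hz, hzs⟩ := hit s hm
          have d1 : ¬ Disjoint s (insert x A) := by
            rw [Finset.not_disjoint_iff]; exact ⟨z, hzs, by simp [hz]⟩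
          have d2 : ¬ Disjoint s (insert y A) := by
            rw [Finset.not_disjoint_iff]; exact ⟨z, hzs, by simp [hz]⟩
          simp [d1, d2]
        · have : x ∈ s ↔ y ∈ s := by
            unfold symEdges at hm
            rw [Finset.mem_filter] at hm
            tauto
          rw [Finset.disjoint_insert_right, Finset.disjoint_insert_right, this])
  apply hx'
  rw [← this]
  simp

lemma no_small_transversal {n k : ℕ} (F : Finset (Finset (Fin n))) (hF : Separates k F)
    (hFk : ∀ e ∈ F, e.card = k) (x y : Fin n) (hn : 3 * k ≤ n)
    (hk : 3 ≤ k) (hxy : x ≠ y) (hc : (symEdges F x y).card ≤ k - 1)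
    (A : Finset (Fin n)) (hA : A.card ≤ k - 2) (hx : x ∉ A) (hy : y ∉ A)
    (hit : ∀ e ∈ symEdges F x y, ∃ z ∈ A, z ∈ e) : False := by
  obtain ⟨B, hAB, hBs, hBc⟩ : ∃ B, A ⊆ B ∧ B ⊆ Finset.univ \ {x, y} ∧ B.card = k - 2 := by
    apply Finset.exists_subsuperset_card_eq _ hA
    · have h1 := Finset.le_card_sdiff {x, y} (Finset.univ : Finset (Fin n))
      have h2 := Finset.card_le_two (a := x) (b := y)
      simp only [Finset.card_univ, Fintype.card_fin] at h1
      omega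
    · intro z hz
      simp only [Finset.mem_sdiff, Finset.mem_univ, true_and, Finset.mem_insert,
        Finset.mem_singleton]
      rintro (rfl | rfl)
      · exact hx hz
      · exact hy hz
  have hxB : x ∉ B := fun h => by simpa using hBs h
  have hyB : y ∉ B := fun h => by simpa using hBs h
  let T := ((symEdges F x y).filter (fun e => B ⊆ e)).biUnion (fun e => e \ B)
  have hT : T.card ≤ (k - 1) * 2 := by
    have h1 : T.card ≤ ((symEdges F x y).filter (fun e => B ⊆ e)).card * 2 := by
      apply Finset.card_biUnion_le_card_mul
      intro e he
      rw [Finset.mem_filter] at he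
      have h3 := hFk e (Finset.mem_filter.1 he.1).1
      rw [Finset.card_sdiff_of_subset he.2]
      omega
    have h2 := Finset.card_filter_le (symEdges F x y) (fun e => B ⊆ e)
    calc T.card ≤ _ := h1
      _ ≤ _ := Nat.mul_le_mul_right 2 (h2.trans hc)
  obtain ⟨z, -, hz⟩ : ∃ z ∈ (Finset.univ : Finset (Fin n)), z ∉ T ∪ B ∪ {x, y} := by
    apply Finset.exists_mem_notMem_of_card_lt_card
    have h1 := Finset.card_union_le (T ∪ B) {x, y}
    have h2 := Finset.card_union_le T B
    have h3 := Finset.card_le_two (a := x) (b := y)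
    simp only [Finset.card_univ, Fintype.card_fin]
    omega
  simp only [Finset.mem_union, Finset.mem_insert, Finset.mem_singleton, not_or] at hz
  obtain ⟨⟨hzT, hzB⟩, hzx, hzy⟩ := hz
  have key : ∀ w, insert w (insert z B) ∉ symEdges F x y := by
    intro w hw
    apply hzT
    simp only [T, Finset.mem_biUnion, Finset.mem_filter, Finset.mem_sdiff]
    refine ⟨_, ⟨hw, ?_⟩, by simp, hzB⟩
    intro t ht
    simp [ht]
  rcases no_transversal F hF x y hk hxy (insert z B)
    (by rw [Finset.card_insert_of_notMem hzB]; omega)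
    (by simp [hxB, Ne.symm hzx]) (by simp [hyB, Ne.symm hzy])
    (fun e he => by
      obtain ⟨t, ht, hte⟩ := hit e he
      exact ⟨t, by simp [hAB ht], hte⟩) with h | h
  · exact key _ h
  · exact key _ h

lemma sym_card {n k : ℕ} (F : Finset (Finset (Fin n))) (hF : Separates k F)
    (hFk : ∀ e ∈ F, e.card = k) (x y : Fin n) (hn : 3 * k ≤ n)
    (hk : 3 ≤ k) (hxy : x ≠ y) : k ≤ (symEdges F x y).card := by
  by_contra hlt
  have hc : (symEdges F x y).card ≤ k - 1 := by omega
  have hf : ∀ e, ∃ z, e ∈ symEdges F x y → z ∈ e ∧ z ≠ x ∧ z ≠ y := by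
    intro e
    by_cases he : e ∈ symEdges F x y
    · have h2 := hFk e (Finset.mem_filter.1 he).1
      obtain ⟨z, hz, hz'⟩ : ∃ z ∈ e, z ∉ ({x, y} : Finset (Fin n)) := by
        apply Finset.exists_mem_notMem_of_card_lt_card
        have h3 := Finset.card_le_two (a := x) (b := y)
        omega
      simp only [Finset.mem_insert, Finset.mem_singleton, not_or] at hz'
      exact ⟨z, fun _ => ⟨hz, hz'⟩⟩
    · exact ⟨x, fun h => absurd h he⟩
  choose f hf using hf
  set H := (symEdges F x y).image f with hH
  have hHc : H.card ≤ (symEdges F x y).card := Finset.card_image_le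
  have hxH : x ∉ H := by
    rw [hH, Finset.mem_image]
    rintro ⟨e, he, h⟩
    exact (hf e he).2.1 h
  have hyH : y ∉ H := by
    rw [hH, Finset.mem_image]
    rintro ⟨e, he, h⟩
    exact (hf e he).2.2 h
  have hit : ∀ e ∈ symEdges F x y, ∃ z ∈ H, z ∈ e :=
    fun e he => ⟨f e, Finset.mem_image_of_mem _ he, (hf e he).1⟩
  by_cases hs : H.card ≤ k - 2
  · exact no_small_transversal F hF hFk x y hn hk hxy hc H hs hxH hyH hit
  have hinj : Set.InjOn f (symEdges F x y) := Finset.card_image_iff.1 (by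
    rw [← hH]; omega)
  have main : ∀ w, insert w H ∈ symEdges F x y → False := by
    intro w hw
    set e0 := insert w H with he0
    have hfe : f e0 ∈ H := Finset.mem_image_of_mem _ hw
    refine no_small_transversal F hF hFk x y hn hk hxy hc (H.erase (f e0)) ?_ ?_ ?_ ?_
    · rw [Finset.card_erase_of_mem hfe]; omega
    · exact fun h => hxH (Finset.mem_of_mem_erase h)
    · exact fun h => hyH (Finset.mem_of_mem_erase h)
    · intro e he
      by_cases hee : e = e0
      · have hne : (H.erase (f e0)).Nonempty := by
          rw [← Finset.card_pos, Finset.card_erase_of_mem hfe]; omega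
        obtain ⟨z, hz⟩ := hne
        refine ⟨z, hz, ?_⟩
        rw [hee, he0]
        exact Finset.mem_insert_of_mem (Finset.mem_of_mem_erase hz)
      · refine ⟨f e, Finset.mem_erase.2 ⟨fun h => hee (hinj he hw h),
          Finset.mem_image_of_mem _ he⟩, (hf e he).1⟩
  rcases no_transversal F hF x y hk hxy H (by omega) hxH hyH hit with h | h
  · exact main _ h
  · exact main _ h

/-- The degree of a point. -/
def dg {n : ℕ} (F : Finset (Finset (Fin n))) (x : Fin n) : ℕ := (F.filter (fun s => x ∈ s)).card

lemma dg_add {n : ℕ} (F : Finset (Finset (Fin n))) (x y : Fin n) :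
    (symEdges F x y).card + 2 * (F.filter (fun s => x ∈ s ∧ y ∈ s)).card = dg F x + dg F y := by
  unfold symEdges dg
  simp only [Finset.card_filter, Finset.mul_sum, ← Finset.sum_add_distrib]
  apply Finset.sum_congr rfl
  intro s _
  by_cases h1 : x ∈ s <;> by_cases h2 : y ∈ s <;> simp [h1, h2]

lemma sum_weight {n : ℕ} (F : Finset (Finset (Fin n))) (g : Fin n → ℚ) :
    ∑ e ∈ F, ∑ x ∈ e, g x = ∑ x, (dg F x : ℚ) * g x := by
  have : ∀ e ∈ F, ∑ x ∈ e, g x = ∑ x, if x ∈ e then g x else 0 := by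
    intro e _
    simp
  rw [Finset.sum_congr rfl this, Finset.sum_comm]
  apply Finset.sum_congr rfl
  intro x _
  rw [← Finset.sum_filter, Finset.sum_const, nsmul_eq_mul]
  rfl

lemma sum_dg {n k : ℕ} (F : Finset (Finset (Fin n))) (hFk : ∀ e ∈ F, e.card = k) :
    ∑ x, (dg F x : ℚ) = k * F.card := by
  have := sum_weight F (fun _ => 1)
  simp only [mul_one] at this
  rw [← this, Finset.sum_congr rfl (fun e he => by
    rw [Finset.sum_const, hFk e he, nsmul_eq_mul, mul_one]), Finset.sum_const, nsmul_eq_mul]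
  ring

/-- Edge weight bound when all degrees on the edge are at least two. -/
lemma edge_bound {n k : ℕ} (F : Finset (Finset (Fin n))) (hk : 3 ≤ k)
    (hadj : ∀ x y, x ≠ y → (∃ e ∈ F, x ∈ e ∧ y ∈ e) → k + 2 ≤ dg F x + dg F y)
    (e : Finset (Fin n)) (he : e ∈ F) (hek : e.card = k) (a0 : ℕ)
    (c : ℚ) (hc0 : ∀ b : ℕ, k + 2 ≤ 2 * b → (k : ℚ) / b ≤ c)
    (hc : ∀ a : ℕ, a0 ≤ a → 2 * a < k + 2 → (1 : ℚ) / a + (k - 1) / (k + 2 - a) ≤ c)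
    (h2 : ∀ x ∈ e, a0 ≤ dg F x) :
    ∑ x ∈ e, (1 : ℚ) / dg F x ≤ c := by
  have hk' : (3 : ℚ) ≤ k := by exact_mod_cast hk
  by_cases hlow : ∃ x ∈ e, 2 * dg F x < k + 2
  · obtain ⟨x, hx, hxl⟩ := hlow
    refine le_trans ?_ (hc (dg F x) (h2 x hx) hxl)
    rw [← Finset.add_sum_erase e _ hx]
    have hxq : 2 * (dg F x : ℚ) < k + 2 := by exact_mod_cast hxl
    have hb : ∀ y ∈ e.erase x, (1 : ℚ) / dg F y ≤ 1 / (k + 2 - dg F x) := by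
      intro y hy
      rw [Finset.mem_erase] at hy
      have h := hadj x y hy.1.symm ⟨e, he, hx, hy.2⟩
      have hq : (k : ℚ) + 2 ≤ dg F x + dg F y := by exact_mod_cast h
      apply one_div_le_one_div_of_le <;> linarith
    have := Finset.sum_le_card_nsmul _ _ _ hb
    rw [Finset.card_erase_of_mem hx, hek, nsmul_eq_mul, Nat.cast_sub (by omega)] at this
    have e1 : ((k : ℚ) - (1 : ℕ)) * (1 / (k + 2 - dg F x)) = (k - 1) / (k + 2 - dg F x) := by
      push_cast; ring
    rw [e1] at this
    linarith
  · push Not at hlow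
    have hb : ∀ y ∈ e, (1 : ℚ) / dg F y ≤ c / k := by
      intro y hy
      have hq := hc0 _ (hlow y hy)
      rw [le_div_iff₀ (by linarith)]
      calc (1 : ℚ) / dg F y * k = k / dg F y := by ring
        _ ≤ c := hq
    have := Finset.sum_le_card_nsmul _ _ _ hb
    rw [hek, nsmul_eq_mul] at this
    calc _ ≤ _ := this
      _ = _ := by field_simp

/-- Bound for edges without points of low degree. -/
lemma high_bound (k b : ℕ) (h : k + 2 ≤ 2 * b) : (k : ℚ) / b ≤ 2 * (k : ℚ) / (k + 2) := by
  have hq : (k : ℚ) + 2 ≤ 2 * b := by exact_mod_cast h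
  have hk : (0 : ℚ) ≤ k := by positivity
  rw [div_le_div_iff₀ (by linarith) (by linarith)]
  nlinarith

lemma high_bound_three (b : ℕ) (h : 3 + 2 ≤ 2 * b) : ((3 : ℕ) : ℚ) / b ≤ 1 := by
  have hq : (3 : ℚ) ≤ b := by exact_mod_cast (by omega : 3 ≤ b)
  rw [div_le_one (by linarith)]
  exact_mod_cast hq

lemma low_bound (k a : ℕ) (hk : 3 ≤ k) (ha : 2 ≤ a) (h : 2 * a < k + 2) :
    (1 : ℚ) / a + (k - 1) / (k + 2 - a) ≤ 2 * (k : ℚ) / (k + 2) := by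
  have hk' : (3 : ℚ) ≤ k := by exact_mod_cast hk
  have ha' : (2 : ℚ) ≤ a := by exact_mod_cast ha
  have h' : 2 * (a : ℚ) < k + 2 := by exact_mod_cast h
  have p1 : (0 : ℚ) < a := by linarith
  have p2 : (0 : ℚ) < k + 2 - a := by linarith
  have p3 : (0 : ℚ) < k + 2 := by linarith
  have : 2 * (k : ℚ) / (k + 2) - (1 / a + (k - 1) / (k + 2 - a))
      = (k + 2 - 2 * a) * (k * a - (k + 2)) / (a * (k + 2 - a) * (k + 2)) := by
    field_simp
    ring
  have h3 : 0 ≤ (k + 2 - 2 * a) * (k * a - (k + 2)) / ((a : ℚ) * (k + 2 - a) * (k + 2)) := by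
    apply div_nonneg
    · apply mul_nonneg <;> nlinarith
    · positivity
  linarith

lemma main_bound {n k : ℕ} (F : Finset (Finset (Fin n))) (hF : Separates k F)
    (hFk : ∀ e ∈ F, e.card = k) (hk : 3 ≤ k) (hn : 3 * k ≤ n) (hn3 : k = 3 → 18 ≤ n) :
    (n : ℚ) * (k + 2) ≤ 2 * k * F.card := by
  have hk' : (3 : ℚ) ≤ k := by exact_mod_cast hk
  have hn' : 3 * (k : ℚ) ≤ n := by exact_mod_cast hn
  have hpair : ∀ x y, x ≠ y → k ≤ dg F x + dg F y := by
    intro x y hxy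
    have h1 := sym_card F hF hFk x y hn hk hxy
    have h2 := dg_add F x y
    omega
  have hadj : ∀ x y, x ≠ y → (∃ e ∈ F, x ∈ e ∧ y ∈ e) → k + 2 ≤ dg F x + dg F y := by
    rintro x y hxy ⟨e, he, hx, hy⟩
    have h1 := sym_card F hF hFk x y hn hk hxy
    have h2 := dg_add F x y
    have h3 : 0 < (F.filter (fun s => x ∈ s ∧ y ∈ s)).card :=
      Finset.card_pos.2 ⟨e, Finset.mem_filter.2 ⟨he, hx, hy⟩⟩
    omega
  have hsum := sum_dg F hFk
  have hone : (∀ x, 0 < dg F x) → ∑ e ∈ F, ∑ x ∈ e, (1 : ℚ) / dg F x = n := by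
    intro hpos
    rw [sum_weight, Finset.sum_congr rfl (g := fun _ => (1 : ℚ))]
    · simp
    · intro x _
      have := hpos x
      field_simp
  by_cases hz : ∃ x, dg F x = 0
  · obtain ⟨x, hx⟩ := hz
    have hb : ∀ y ∈ Finset.univ.erase x, (k : ℚ) ≤ dg F y := by
      intro y hy
      have := hpair x y (Finset.ne_of_mem_erase hy).symm
      rw [hx] at this
      exact_mod_cast (by omega : k ≤ dg F y)
    have h1 := Finset.card_nsmul_le_sum _ _ _ hb
    rw [← Finset.add_sum_erase _ _ (Finset.mem_univ x), hx] at hsum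
    rw [Finset.card_erase_of_mem (Finset.mem_univ x), Finset.card_univ, Fintype.card_fin,
      nsmul_eq_mul, Nat.cast_sub (by omega)] at h1
    push_cast at h1 hsum
    nlinarith
  push Not at hz
  have hpos : ∀ x, 0 < dg F x := fun x => Nat.pos_of_ne_zero (hz x)
  by_cases ho : ∃ x, dg F x = 1
  · obtain ⟨x, hx⟩ := ho
    by_cases hk3 : k = 3
    · subst hk3
      have hn18 : (18 : ℚ) ≤ n := by exact_mod_cast hn3 rfl
      have hge2 : ∀ y, y ≠ x → 2 ≤ dg F y := by
        intro y hy
        have := hpair x y hy.symm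
        omega
      have hE := Finset.card_eq_one.1 hx
      obtain ⟨E, hE⟩ := hE
      have hEm : E ∈ F ∧ x ∈ E := by
        have : E ∈ F.filter (fun s => x ∈ s) := by rw [hE]; simp
        exact Finset.mem_filter.1 this
      have b1 : ∑ z ∈ E, (1 : ℚ) / dg F z ≤ 3 / 2 := by
        refine edge_bound F hk hadj E hEm.1 (hFk E hEm.1) 1 _
          (fun b hb => (high_bound_three b hb).trans (by norm_num)) ?_
          (fun z _ => hpos z)
        intro a h1 h2
        have : a = 1 ∨ a = 2 := by omega
        rcases this with rfl | rfl <;> norm_num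
      have b2 : ∀ e ∈ F.erase E, ∑ z ∈ e, (1 : ℚ) / dg F z ≤ 7 / 6 := by
        intro e he
        rw [Finset.mem_erase] at he
        have hxe : x ∉ e := by
          intro hxe
          have h : e ∈ F.filter (fun s => x ∈ s) := Finset.mem_filter.2 ⟨he.2, hxe⟩
          rw [hE, Finset.mem_singleton] at h
          exact he.1 h
        refine edge_bound F hk hadj e he.2 (hFk e he.2) 2 _
          (fun b hb => (high_bound_three b hb).trans (by norm_num)) ?_
          (fun z hz => hge2 z (fun h => hxe (h ▸ hz)))
        intro a h1 h2
        have : a = 2 := by omega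
        subst this
        norm_num
      have h1 := hone hpos
      rw [← Finset.add_sum_erase _ _ hEm.1] at h1
      have h2 := Finset.sum_le_card_nsmul _ _ _ b2
      have hFp : 0 < F.card := Finset.card_pos.2 ⟨E, hEm.1⟩
      rw [Finset.card_erase_of_mem hEm.1, nsmul_eq_mul, Nat.cast_sub (by omega)] at h2
      push_cast at h2 ⊢
      have h3 : (n : ℚ) ≤ 7 / 6 * F.card + 1 / 3 := by linarith
      linarith
    · have hk4 : (4 : ℚ) ≤ k := by exact_mod_cast (by omega : 4 ≤ k)
      obtain ⟨E, hE⟩ := Finset.card_eq_one.1 hx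
      have hEm : E ∈ F ∧ x ∈ E := by
        have : E ∈ F.filter (fun s => x ∈ s) := by rw [hE]; simp
        exact Finset.mem_filter.1 this
      have hb : ∀ y ∈ Finset.univ, (k : ℚ) - 1 + (if y ∈ E then 2 else 0)
          - (if y = x then (k : ℚ) else 0) ≤ dg F y := by
        intro y _
        by_cases hyx : y = x
        · subst hyx
          simp only [hEm.2, if_true, hx]
          push_cast
          linarith
        · by_cases hyE : y ∈ E
          · have := hadj x y (Ne.symm hyx) ⟨E, hEm.1, hEm.2, hyE⟩
            have h : (k : ℚ) + 2 ≤ 1 + dg F y := by rw [hx] at this; exact_mod_cast this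
            simp only [hyE, hyx, if_true, if_false]
            linarith
          · have := hpair x y (Ne.symm hyx)
            have h : (k : ℚ) ≤ 1 + dg F y := by rw [hx] at this; exact_mod_cast this
            simp only [hyE, hyx, if_false]
            linarith
      have h1 := Finset.sum_le_sum hb
      rw [hsum] at h1
      simp only [Finset.sum_sub_distrib, Finset.sum_add_distrib, Finset.sum_const,
        Finset.card_univ, Fintype.card_fin, nsmul_eq_mul, Finset.sum_ite_mem, Finset.univ_inter,
        hFk E hEm.1, Finset.sum_ite_eq', Finset.mem_univ, if_true] at h1
      nlinarith
  · push Not at ho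
    have h2 : ∀ x, 2 ≤ dg F x := by
      intro x
      have := hz x
      have := ho x
      omega
    have h1 := hone hpos
    have h3 := Finset.sum_le_card_nsmul F _ _ (fun e he =>
      edge_bound F hk hadj e he (hFk e he) 2 _ (fun b hb => high_bound k b hb)
        (fun a h h' => low_bound k a hk h h') (fun x _ => h2 x))
    rw [h1, nsmul_eq_mul, ← mul_div_assoc, le_div_iff₀ (by linarith)] at h3
    linarith

theorem stmt_6 (k n : ℕ) (hk : 3 ≤ k) (hn : 3 * k ≤ n) (hn3 : k = 3 → 18 ≤ n)
    (S : Finset {s : Finset (Fin n) // s.card = k})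
    (hres : IsResolvingSet (Kneser k n) ↑S) :
    (k ≠ 4 → (n : ℚ) / 2 + (n : ℚ) / k ≤ S.card) ∧
    (k = 4 → (3 * (n : ℚ) - 1) / 4 ≤ S.card) := by
  have h := main_bound (S.image Subtype.val) (separates_of_resolving hk hn S hres) (by
    intro e he
    rw [Finset.mem_image] at he
    obtain ⟨s, _, rfl⟩ := he
    exact s.2) hk hn hn3
  rw [Finset.card_image_of_injective _ Subtype.val_injective] at h
  constructor
  · intro _
    have hk' : (0 : ℚ) < k := by exact_mod_cast (by omega : 0 < k)
    have e : (n : ℚ) / 2 + (n : ℚ) / k = (n * (k + 2)) / (2 * k) := by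
      field_simp
    rw [e, div_le_iff₀ (by positivity)]
    linarith
  · rintro rfl
    push_cast at h
    linarith
end

section
/- In a k-regular Moore graph G of diameter 2 (so G has girth 5 and k²+1 vertices), the metric dimension satisfies β(G) ≥ k, for k ≥ 3. -/
theorem stmt_9 {V : Type*} [Fintype V] (G : SimpleGraph V) [DecidableRel G.Adj]
    (k : ℕ) (hk : 3 ≤ k) (hreg : G.IsRegularOfDegree k)
    (hgirth : G.girth = 5) (hdiam : G.diam = 2)
    (S : Finset V) (hres : IsResolvingSet G ↑S) :
    k ≤ S.card := by
  classical
  have hlen : ∀ (a : V) (w : G.Walk a a), w.IsCycle → 5 ≤ w.length := by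
    intro a w hw
    have := hw.girth_le_length
    omega
  have h3 : ∀ a b c : V, G.Adj a b → G.Adj b c → G.Adj c a → False := by
    intro a b c hab hbc hca
    have := hlen a (.cons hab (.cons hbc (.cons hca .nil))) (by
      simp [SimpleGraph.Walk.isCycle_def, SimpleGraph.Walk.isTrail_def]
      have := hab.ne; have := hbc.ne; have := hca.ne
      grind)
    simp at this
  have h4 : ∀ a b c d : V, a ≠ c → b ≠ d → G.Adj a b → G.Adj b c → G.Adj c d → G.Adj d a → False := by
    intro a b c d hac hbd hab hbc hcd hda
    have := hlen a (.cons hab (.cons hbc (.cons hcd (.cons hda .nil)))) (by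
      simp [SimpleGraph.Walk.isCycle_def, SimpleGraph.Walk.isTrail_def]
      have := hab.ne; have := hbc.ne; have := hcd.ne; have := hda.ne
      grind)
    simp at this
  have hed : G.ediam ≠ ⊤ := by
    intro h
    simp [SimpleGraph.diam, h] at hdiam
  have hle : ∀ a b, G.dist a b ≤ 2 := fun a b => hdiam ▸ SimpleGraph.dist_le_diam hed
  have hnt : Nontrivial V := SimpleGraph.nontrivial_of_diam_ne_zero (G := G) (by omega)
  have hconn : G.Connected := SimpleGraph.connected_of_ediam_ne_top hed
  have hd2 : ∀ a b, a ≠ b → ¬ G.Adj a b → G.dist a b = 2 := by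
    intro a b hab hadj
    have h0 := hconn.pos_dist_of_ne hab
    have h1 : G.dist a b ≠ 1 := fun h => hadj (SimpleGraph.dist_eq_one_iff_adj.1 h)
    have := hle a b
    omega
  obtain ⟨s, hs⟩ : S.Nonempty := by
    rw [Finset.nonempty_iff_ne_empty]
    rintro rfl
    obtain ⟨u, v, huv⟩ := hnt
    exact huv (hres u v (by simp))
  have hex : ∀ w, ∃ t ∈ S, (t ≠ s ∧ (t = w ∨ G.Adj t w)) ∨
      (t = s ∧ ∀ r ∈ S, r ≠ s → r ≠ w ∧ ¬ G.Adj r w) := by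
    intro w
    by_cases h : ∃ t ∈ S, t ≠ s ∧ (t = w ∨ G.Adj t w)
    · obtain ⟨t, ht, h⟩ := h
      exact ⟨t, ht, Or.inl h⟩
    · push Not at h
      exact ⟨s, hs, Or.inr ⟨rfl, h⟩⟩
  choose g hgS hg using hex
  rw [← hreg s, ← SimpleGraph.card_neighborFinset_eq_degree]
  refine Finset.card_le_card_of_injOn g (fun w _ => hgS w) ?_
  intro w hw w' hw' heq
  simp only [Finset.mem_coe, SimpleGraph.mem_neighborFinset] at hw hw'
  by_contra hne
  have h1 := hg w
  have h2 := hg w'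
  rw [← heq] at h2
  rcases h1 with ⟨hts, h1⟩ | ⟨hts, h1⟩
  · rcases h2 with ⟨-, h2⟩ | ⟨h, -⟩
    · rcases h1 with h1 | h1 <;> rcases h2 with h2 | h2
      · exact hne (h1.symm.trans h2)
      · rw [h1] at h2
        exact h3 s w w' hw h2 hw'.symm
      · rw [h2] at h1
        exact h3 s w' w hw' h1 hw.symm
      · exact h4 s w (g w) w' hts.symm hne hw h1.symm h2 hw'.symm
    · exact hts h
  · rcases h2 with ⟨h, -⟩ | ⟨-, h2⟩
    · exact h hts
    · apply hne
      apply hres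
      intro r hr
      by_cases hrs : r = s
      · subst hrs
        rw [SimpleGraph.dist_eq_one_iff_adj.2 hw, SimpleGraph.dist_eq_one_iff_adj.2 hw']
      · rw [hd2 r w (h1 r hr hrs).1 (h1 r hr hrs).2, hd2 r w' (h2 r hr hrs).1 (h2 r hr hrs).2]
end
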